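/- Let α ∈ (0,1) and 0 < λ < λ′. Then there exist constants c₀ > 0 and C̄ > 0, depending only on α, λ, λ′ (in particular independent of T, of the mesh, and of m), such that the following holds: for every T > 0, every temporal mesh on [0,T], and every m ∈ {1,…,M} with τ_j ≤ c₀ for all j = 1,…,m, if a real sequence (V^j)_{j=0}^M satisfies V⁰ = 0 and |(δ_t^α V^j) − λ V^j| ≤ (τ/t_j)^α for all j = 1,…,m, then |V^j| ≤ C̄ τ^α E_α(λ′ t_j^α) for all j = 1,…,m. -/

import Mathlib

open Real MeasureTheory

/-- The L1 discrete Caputo operator of order `α` on the temporal mesh `t`. -/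
noncomputable def deltaL1 (α : ℝ) (t : ℕ → ℝ) (V : ℕ → ℝ) (m : ℕ) : ℝ :=
  (1 / Real.Gamma (1 - α)) *
    ∑ j ∈ Finset.Icc 1 m,
      ((V j - V (j - 1)) / (t j - t (j - 1))) *
        ∫ s in (t (j - 1))..(t j), (t m - s) ^ (-α)
/-- The Mittag-Leffler function of order `α`. -/
noncomputable def mittagLeffler (α s : ℝ) : ℝ :=
  ∑' k : ℕ, s ^ k / Real.Gamma (k * α + 1)


theorem rbeta_integral (a b x : ℝ) (ha : 0 < a) (hb : 0 < b) (hx : 0 < x) :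
    ∫ s in (0:ℝ)..x, s ^ (a - 1) * (x - s) ^ (b - 1)
      = x ^ (a + b - 1) * (Real.Gamma a * Real.Gamma b / Real.Gamma (a + b)) := by
  have h := Complex.betaIntegral_scaled (a : ℂ) (b : ℂ) hx
  have hG := Complex.Gamma_mul_Gamma_eq_betaIntegral (s := (a : ℂ)) (t := (b : ℂ))
    (by simpa using ha) (by simpa using hb)
  have hne : Real.Gamma (a + b) ≠ 0 := (Real.Gamma_pos_of_pos (by positivity)).ne'
  have hne' : Complex.Gamma ((a : ℂ) + b) ≠ 0 := by
    rw [← Complex.ofReal_add, Complex.Gamma_ofReal]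
    exact_mod_cast hne
  have h1 : ((∫ s in (0:ℝ)..x, s ^ (a - 1) * (x - s) ^ (b - 1) : ℝ) : ℂ)
      = ∫ s in (0:ℝ)..x, (s : ℂ) ^ ((a : ℂ) - 1) * ((x : ℂ) - s) ^ ((b : ℂ) - 1) := by
    rw [← intervalIntegral.integral_ofReal]
    apply intervalIntegral.integral_congr
    intro s hs
    rw [Set.uIcc_of_le hx.le] at hs
    have h2 : 0 ≤ x - s := by linarith [hs.2]
    simp only [Complex.ofReal_mul]
    rw [Complex.ofReal_cpow hs.1, Complex.ofReal_cpow h2]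
    push_cast
    rfl
  have h3 : Complex.betaIntegral a b
      = ((Real.Gamma a * Real.Gamma b / Real.Gamma (a + b) : ℝ) : ℂ) := by
    push_cast
    rw [← Complex.Gamma_ofReal, ← Complex.Gamma_ofReal, ← Complex.Gamma_ofReal, Complex.ofReal_add,
      hG]
    field_simp
  rw [h, h3] at h1
  have h4 : (x : ℂ) ^ ((a : ℂ) + b - 1) = ((x ^ (a + b - 1) : ℝ) : ℂ) := by
    rw [Complex.ofReal_cpow hx.le]
    push_cast
    rfl
  rw [h4] at h1
  exact_mod_cast h1

theorem rbeta_integrable (a b x : ℝ) (ha : 0 < a) (hb : 0 < b) (hx : 0 < x) :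
    IntervalIntegrable (fun s => s ^ (a - 1) * (x - s) ^ (b - 1)) volume 0 x := by
  by_contra hcon
  have h := intervalIntegral.integral_undef hcon
  rw [rbeta_integral a b x ha hb hx] at h
  have h1 := Real.Gamma_pos_of_pos ha
  have h2 := Real.Gamma_pos_of_pos hb
  have h3 := Real.Gamma_pos_of_pos (add_pos ha hb)
  have : 0 < x ^ (a + b - 1) * (Real.Gamma a * Real.Gamma b / Real.Gamma (a + b)) := by
    positivity
  linarith

theorem ker_integrable (α T a b : ℝ) (hα : α < 1) :
    IntervalIntegrable (fun s => (T - s) ^ (-α)) volume a b := by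
  have h := (intervalIntegral.intervalIntegrable_rpow' (a := T - a) (b := T - b)
    (r := -α) (by linarith)).comp_sub_left T
  simpa using h

theorem partial_le_exp (α x : ℝ) (hα : 0 < α) (hx : 0 ≤ x) (N : ℕ) :
    ∑ k ∈ Finset.range N, x ^ ((k : ℝ) + α) / Real.Gamma (k + α + 1) ≤ Real.exp x := by
  rcases hx.eq_or_lt with rfl | hx
  · rw [Finset.sum_eq_zero]
    · positivity
    · intro k _
      rw [Real.zero_rpow (by positivity)]
      simp
  have hGα := Real.Gamma_pos_of_pos hα
  have hIntk : ∀ k : ℕ, IntervalIntegrable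
      (fun s : ℝ => s ^ (α - 1) * ((x - s) ^ k / (k.factorial : ℝ)) ) volume 0 x := by
    intro k
    have h := (rbeta_integrable α (k + 1) x hα (by positivity) hx).div_const (k.factorial : ℝ)
    simp only [add_sub_cancel_right, Real.rpow_natCast] at h
    simpa only [mul_div_assoc] using h
  have hterm : ∀ k : ℕ, x ^ ((k : ℝ) + α) / Real.Gamma (k + α + 1)
      = (1 / Real.Gamma α) * ∫ s in (0:ℝ)..x, s ^ (α - 1) * ((x - s) ^ k / (k.factorial : ℝ)) := by
    intro k
    have h := rbeta_integral α (k + 1) x hα (by positivity) hx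
    simp only [add_sub_cancel_right, Real.rpow_natCast] at h
    simp only [← mul_div_assoc]
    rw [intervalIntegral.integral_div, h, Real.Gamma_nat_eq_factorial]
    rw [show α + ((k : ℝ) + 1) - 1 = k + α by ring, show α + ((k : ℝ) + 1) = k + α + 1 by ring]
    have h1 : (k.factorial : ℝ) ≠ 0 := by positivity
    have h2 := (Real.Gamma_pos_of_pos (show 0 < (k : ℝ) + α + 1 by positivity)).ne'
    field_simp
  simp_rw [hterm]
  rw [← Finset.mul_sum, ← intervalIntegral.integral_finsetSum (fun k _ => hIntk k)]
  have hGint := Real.GammaIntegral_convergent hα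
  have hexpI : IntervalIntegrable (fun s => Real.exp (-s) * s ^ (α - 1)) volume 0 x := by
    rw [intervalIntegrable_iff_integrableOn_Ioc_of_le hx.le]
    exact hGint.mono_set (fun s hs => hs.1)
  have h1 : ∫ s in (0:ℝ)..x, ∑ k ∈ Finset.range N, s ^ (α - 1) * ((x - s) ^ k / (k.factorial : ℝ))
      ≤ ∫ s in (0:ℝ)..x, Real.exp x * (Real.exp (-s) * s ^ (α - 1)) := by
    apply intervalIntegral.integral_mono_on hx.le
    · have := IntervalIntegrable.sum (Finset.range N) (fun k _ => hIntk k)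
      rwa [show (∑ k ∈ Finset.range N, fun s : ℝ => s ^ (α - 1) * ((x - s) ^ k / (k.factorial : ℝ)))
        = fun s => ∑ k ∈ Finset.range N, s ^ (α - 1) * ((x - s) ^ k / (k.factorial : ℝ)) from by
          funext s; simp] at this
    · exact hexpI.const_mul _
    · intro s hs
      rw [← Finset.mul_sum, ← mul_assoc, ← Real.exp_add, mul_comm]
      have h2 := Real.sum_le_exp_of_nonneg (show 0 ≤ x - s by linarith [hs.2]) N
      have h3 : 0 ≤ s ^ (α - 1) := Real.rpow_nonneg hs.1 _
      exact mul_le_mul_of_nonneg_right h2 h3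
  rw [intervalIntegral.integral_const_mul] at h1
  have h4 : ∫ s in (0:ℝ)..x, Real.exp (-s) * s ^ (α - 1) ≤ Real.Gamma α := by
    rw [Real.Gamma_eq_integral hα, intervalIntegral.integral_of_le hx.le]
    apply setIntegral_mono_set hGint
    · filter_upwards [ae_restrict_mem measurableSet_Ioi] with s hs
      have : (0:ℝ) < s := hs
      simp only [Pi.zero_apply]
      positivity
    · exact Filter.Eventually.of_forall (fun s hs => hs.1)
  calc _ ≤ (1 / Real.Gamma α) * (Real.exp x * Real.Gamma α) := by
        apply mul_le_mul_of_nonneg_left _ (by positivity)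
        exact h1.trans (mul_le_mul_of_nonneg_left h4 (Real.exp_pos _).le)
    _ = Real.exp x := by field_simp

/-- Lower bound for the Gamma function. -/
theorem Gamma_lower (s R : ℝ) (hs : 0 ≤ s) (hR : 0 ≤ R) :
    R ^ s * Real.exp (-R) ≤ Real.Gamma (s + 1) := by
  rw [Real.Gamma_eq_integral (by linarith), ← integral_exp_neg_Ioi, ← integral_const_mul]
  have hI := Real.GammaIntegral_convergent (show 0 < s + 1 by linarith)
  calc _ ≤ ∫ x in Set.Ioi R, Real.exp (-x) * x ^ (s + 1 - 1) := by
        apply setIntegral_mono_on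
        · exact (integrableOn_exp_neg_Ioi R).const_mul _
        · exact hI.mono_set (Set.Ioi_subset_Ioi hR)
        · exact measurableSet_Ioi
        · intro x hx
          have hx' : R < x := hx
          rw [add_sub_cancel_right, mul_comm]
          exact mul_le_mul_of_nonneg_left (Real.rpow_le_rpow hR hx'.le hs) (Real.exp_pos _).le
    _ ≤ _ := by
        apply setIntegral_mono_set hI
        · filter_upwards [ae_restrict_mem measurableSet_Ioi] with s hs
          have : (0:ℝ) < s := hs
          simp only [Pi.zero_apply]
          positivity
        · exact Filter.Eventually.of_forall (fun s hs => lt_of_le_of_lt hR hs)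

theorem ml_summable (α x : ℝ) (hα : 0 < α) (hx : 0 ≤ x) :
    Summable (fun k : ℕ => x ^ k / Real.Gamma (k * α + 1)) := by
  set R : ℝ := (2 * (x + 1)) ^ (1 / α) with hRdef
  have hR0 : 0 < R := by positivity
  have hRα : R ^ α = 2 * (x + 1) := by
    rw [hRdef, ← Real.rpow_mul (by positivity)]
    field_simp
    simp
  refine Summable.of_nonneg_of_le (f := fun k : ℕ => Real.exp R * (1 / 2 : ℝ) ^ k) ?_ ?_ ?_
  · intro k
    have := Real.Gamma_pos_of_pos (show 0 < (k : ℝ) * α + 1 by positivity)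
    positivity
  · intro k
    have hG := Real.Gamma_pos_of_pos (show 0 < (k : ℝ) * α + 1 by positivity)
    have h := Gamma_lower (k * α) R (by positivity) hR0.le
    rw [mul_comm (k : ℝ) α, Real.rpow_mul hR0.le, hRα, Real.rpow_natCast, Real.exp_neg,
      mul_comm α] at h
    rw [div_le_iff₀ hG]
    calc x ^ k ≤ (x + 1) ^ k := by gcongr; linarith
      _ = Real.exp R * (1 / 2 : ℝ) ^ k * ((2 * (x + 1)) ^ k * (Real.exp R)⁻¹) := by
        rw [mul_pow, div_pow, one_pow]
        field_simp
      _ ≤ _ := by gcongr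
  · exact (summable_geometric_of_lt_one (by norm_num) (by norm_num)).mul_left _

theorem exp_le_ml (α lam' β t : ℝ) (hα : 0 < α) (hα1 : α < 1) (hl : 0 < lam') (hβ : 0 < β)
    (hβl : β < lam' ^ (1 / α)) (ht : 0 ≤ t) :
    Real.exp (β * t) ≤ (Real.exp 1 / (1 - β / lam' ^ (1 / α))) *
      mittagLeffler α (lam' * t ^ α) := by
  set L := lam' ^ (1 / α) with hL
  have hL0 : 0 < L := by positivity
  set q := β / L with hq
  have hq0 : 0 < q := by positivity
  have hq1 : q < 1 := by rw [hq, div_lt_one hL0]; exact hβl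
  set x := L * t with hx
  have hx0 : 0 ≤ x := by positivity
  have hbt : β * t = q * x := by rw [hq, hx]; field_simp
  have harg : lam' * t ^ α = x ^ α := by
    rw [hx, Real.mul_rpow hL0.le ht, hL, ← Real.rpow_mul hl.le]
    field_simp
    simp [mul_comm]
  rw [hbt, harg]
  have hxα : 0 ≤ x ^ α := by positivity
  have hsum := ml_summable α (x ^ α) hα hxα
  have hnn : ∀ k : ℕ, 0 ≤ (x ^ α) ^ k / Real.Gamma (k * α + 1) := by
    intro k
    have := Real.Gamma_pos_of_pos (show 0 < (k : ℝ) * α + 1 by positivity)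
    positivity
  have hq1' : 0 < 1 - q := by linarith
  unfold mittagLeffler
  rcases le_or_gt x 1 with hx1 | hx1
  · have h1 : 1 ≤ ∑' k : ℕ, (x ^ α) ^ k / Real.Gamma (k * α + 1) := by
      have := hsum.le_tsum 0 (fun k _ => hnn k)
      simpa using this
    have h2 : Real.exp (q * x) ≤ Real.exp 1 := by
      apply Real.exp_le_exp.mpr
      nlinarith
    have h3 : Real.exp 1 ≤ Real.exp 1 / (1 - q) := by
      rw [le_div_iff₀ hq1']
      nlinarith [Real.exp_pos 1]
    calc _ ≤ Real.exp 1 / (1 - q) * 1 := by linarith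
      _ ≤ _ := by gcongr
  · have h1 : Real.exp (q * x) ≤ ∑' k : ℕ, (1 / (1 - q)) * ((x ^ α) ^ k / Real.Gamma (k * α + 1)) := by
      rw [Real.exp_eq_exp_ℝ, NormedSpace.exp_eq_tsum_div]
      refine Summable.tsum_le_tsum_of_inj (fun n : ℕ => ⌈(n : ℝ) / α⌉₊) ?_ ?_ ?_ ?_ ?_
      · apply StrictMono.injective
        apply strictMono_nat_of_lt_succ
        intro n
        rw [Nat.lt_ceil]
        have h1 := Nat.ceil_lt_add_one (show 0 ≤ (n : ℝ) / α by positivity)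
        have h2 : 1 < 1 / α := by rw [lt_div_iff₀ hα]; linarith
        push_cast
        rw [add_div]
        linarith
      · intro k _
        have := hnn k
        positivity
      · intro n
        set k := ⌈(n : ℝ) / α⌉₊ with hk
        have hk1 : (n : ℝ) ≤ k * α := by
          have := Nat.le_ceil ((n : ℝ) / α)
          rwa [div_le_iff₀ hα] at this
        have hk2 : (k : ℝ) * α ≤ n + 1 := by
          have := (Nat.ceil_lt_add_one (show 0 ≤ (n : ℝ) / α by positivity)).le
          rw [← hk] at this
          have h2 := mul_le_mul_of_nonneg_right this hα.le
          have h3 : ((n : ℝ) / α + 1) * α = n + α := by field_simp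
          linarith
        have hGpos := Real.Gamma_pos_of_pos (show 0 < (k : ℝ) * α + 1 by positivity)
        have hGle : Real.Gamma (k * α + 1) ≤ (n + 1).factorial := by
          rcases Nat.eq_zero_or_pos n with h0 | h0
          · have : k = 0 := by rw [hk, h0]; simp
            rw [this, h0]
            simp
          · rw [← Real.Gamma_nat_eq_factorial]
            have : (1 : ℝ) ≤ n := by exact_mod_cast h0
            apply Real.Gamma_strictMonoOn_Ici.monotoneOn
            · simp only [Set.mem_Ici]; linarith
            · simp only [Set.mem_Ici]; push_cast; linarith
            · push_cast; linarith
        have hxk : x ^ n ≤ (x ^ α) ^ k := by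
          rw [← Real.rpow_natCast, ← Real.rpow_natCast, ← Real.rpow_mul hx0]
          apply Real.rpow_le_rpow_of_exponent_le hx1.le
          linarith
        have hqn : ((n : ℝ) + 1) * q ^ n ≤ 1 / (1 - q) := by
          rw [le_div_iff₀ hq1']
          have hg := geom_sum_mul_neg q (n + 1)
          have h5 : ((n : ℝ) + 1) * q ^ n ≤ ∑ i ∈ Finset.range (n + 1), q ^ i := by
            have := Finset.card_nsmul_le_sum (Finset.range (n + 1)) (fun i => q ^ i) (q ^ n)
              (fun i hi => pow_le_pow_of_le_one hq0.le hq1.le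
                (Nat.lt_succ_iff.mp (Finset.mem_range.mp hi)))
            simpa using this
          calc _ ≤ (∑ i ∈ Finset.range (n + 1), q ^ i) * (1 - q) := by gcongr
            _ = 1 - q ^ (n + 1) := hg
            _ ≤ 1 := by linarith [pow_pos hq0 (n + 1)]
        calc (q * x) ^ n / (n.factorial : ℝ)
            = (((n : ℝ) + 1) * q ^ n) * (x ^ n / ((n + 1).factorial : ℝ)) := by
              rw [Nat.factorial_succ, mul_pow]
              push_cast
              field_simp
          _ ≤ (1 / (1 - q)) * ((x ^ α) ^ k / Real.Gamma (k * α + 1)) := by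
              gcongr
      · exact Real.summable_pow_div_factorial _
      · exact hsum.mul_left _
    rw [tsum_mul_left] at h1
    refine h1.trans ?_
    have hT : 0 ≤ ∑' k : ℕ, (x ^ α) ^ k / Real.Gamma (k * α + 1) := tsum_nonneg hnn
    gcongr
    exact Real.one_le_exp (by norm_num)

theorem deltaL1_range (α : ℝ) (t V : ℕ → ℝ) (n : ℕ) :
    deltaL1 α t V n = (1 / Real.Gamma (1 - α)) *
      ∑ i ∈ Finset.range n, ((V (i + 1) - V i) / (t (i + 1) - t i)) *
        ∫ s in (t i)..(t (i + 1)), (t n - s) ^ (-α) := by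
  unfold deltaL1
  congr 1
  have key : ∀ (f : ℕ → ℝ) (r : ℕ), ∑ j ∈ Finset.Icc 1 r, f j = ∑ i ∈ Finset.range r, f (i + 1) := by
    intro f r
    induction r with
    | zero => simp
    | succ r ih => rw [Finset.sum_Icc_succ_top (by omega), Finset.sum_range_succ, ih]
  rw [key]
  simp

theorem ker_lower (α T a b : ℝ) (hα0 : 0 < α) (hα1 : α < 1) (hab : a < b) (hbT : b ≤ T) :
    (b - a) * (T - a) ^ (-α) ≤ ∫ s in a..b, (T - s) ^ (-α) := by
  have h : ∫ s in a..b, (T - a) ^ (-α) ≤ ∫ s in a..b, (T - s) ^ (-α) := by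
    apply intervalIntegral.integral_mono_on_of_le_Ioo hab.le (by simp) (ker_integrable α T a b hα1)
    intro s hs
    exact Real.rpow_le_rpow_of_nonpos (by linarith [hs.2]) (by linarith [hs.1]) (by linarith)
  simpa using h

theorem ker_upper (α T a b : ℝ) (hα0 : 0 < α) (hα1 : α < 1) (hab : a < b) (hbT : b < T) :
    ∫ s in a..b, (T - s) ^ (-α) ≤ (b - a) * (T - b) ^ (-α) := by
  have h : ∫ s in a..b, (T - s) ^ (-α) ≤ ∫ s in a..b, (T - b) ^ (-α) := by
    apply intervalIntegral.integral_mono_on_of_le_Ioo hab.le (ker_integrable α T a b hα1) (by simp)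
    intro s hs
    exact Real.rpow_le_rpow_of_nonpos (by linarith [hs.2]) (by linarith [hs.2]) (by linarith)
  simpa using h

theorem mesh_le (M : ℕ) (t : ℕ → ℝ) (ht : ∀ j, j < M → t j < t (j + 1)) (i j : ℕ) (hij : i ≤ j)
    (hj : j ≤ M) : t i ≤ t j := by
  induction j, hij using Nat.le_induction with
  | base => exact le_rfl
  | succ j _ ih => exact (ih (by omega)).trans (ht j (by omega)).le

/-- Discrete maximum principle. -/
theorem discrete_max (α : ℝ) (hα0 : 0 < α) (hα1 : α < 1) (M : ℕ) (t : ℕ → ℝ)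
    (ht : ∀ j, j < M → t j < t (j + 1)) (m : ℕ) (hm : m ≤ M) (U : ℕ → ℝ) (hU0 : U 0 ≤ 0)
    (hU : ∀ j, 1 ≤ j → j ≤ m → deltaL1 α t U j ≤ 0) : ∀ j, j ≤ m → U j ≤ 0 := by
  intro n
  induction n using Nat.strong_induction_on with
  | _ n IH =>
    intro hn
    rcases Nat.eq_zero_or_pos n with h0 | hpos
    · rw [h0]; exact hU0
    have hG := Real.Gamma_pos_of_pos (show 0 < 1 - α by linarith)
    have hd := hU n hpos hn
    rw [deltaL1_range] at hd
    set a : ℕ → ℝ := fun i => (∫ s in (t i)..(t (i + 1)), (t n - s) ^ (-α)) / (t (i + 1) - t i)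
      with ha
    have hapos : ∀ i, i < n → 0 < a i := by
      intro i hi
      have h1 := ht i (by omega)
      have h2 := mesh_le M t ht (i + 1) n (by omega) (by omega)
      have h3 := ker_lower α (t n) (t i) (t (i + 1)) hα0 hα1 h1 h2
      have h4 : 0 < t (i + 1) - t i := by linarith
      have h5 : 0 < t n - t i := by linarith
      have : 0 < (t (i + 1) - t i) * (t n - t i) ^ (-α) := by positivity
      exact div_pos (by linarith) h4
    have hamono : ∀ i, i + 1 < n → a i ≤ a (i + 1) := by
      intro i hi
      have h1 := ht i (by omega)
      have h1' := ht (i + 1) (by omega)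
      have h2 := mesh_le M t ht (i + 1 + 1) n (by omega) (by omega)
      have h3 := ker_lower α (t n) (t (i + 1)) (t (i + 1 + 1)) hα0 hα1 h1' h2
      have h3' := ker_upper α (t n) (t i) (t (i + 1)) hα0 hα1 h1 (by linarith)
      have h4 : 0 < t (i + 1) - t i := by linarith
      have h5 : 0 < t (i + 1 + 1) - t (i + 1) := by linarith
      calc a i ≤ (t n - t (i + 1)) ^ (-α) := by
            rw [ha]; simp only; rw [div_le_iff₀ h4]; linarith
        _ ≤ a (i + 1) := by
            rw [ha]; simp only; rw [le_div_iff₀ h5]; linarith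
    have hsum : ∑ i ∈ Finset.range n, ((U (i + 1) - U i) / (t (i + 1) - t i)) *
        ∫ s in (t i)..(t (i + 1)), (t n - s) ^ (-α)
        = ∑ i ∈ Finset.range n, (U (i + 1) - U i) * a i := by
      apply Finset.sum_congr rfl
      intro i _
      rw [ha]; simp only; ring
    rw [hsum] at hd
    have habel : ∀ r, r + 1 ≤ n → a r * U (r + 1) ≤ ∑ i ∈ Finset.range (r + 1),
        (U (i + 1) - U i) * a i := by
      intro r
      induction r with
      | zero =>
        intro h
        simp only [zero_add, Finset.range_one, Finset.sum_singleton]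
        nlinarith [hapos 0 (by omega)]
      | succ r ih =>
        intro h
        rw [Finset.sum_range_succ]
        have h1 := ih (by omega)
        have h2 := hamono r (by omega)
        have h3 := IH (r + 1) (by omega) (by omega)
        nlinarith
    obtain ⟨r, rfl⟩ : ∃ r, n = r + 1 := ⟨n - 1, by omega⟩
    have h1 := habel r le_rfl
    have h2 := hapos r (by omega)
    have h3 : ∑ i ∈ Finset.range (r + 1), (U (i + 1) - U i) * a i ≤ 0 := by
      by_contra hcon
      push Not at hcon
      have : 0 < (1 / Real.Gamma (1 - α)) *
        ∑ i ∈ Finset.range (r + 1), (U (i + 1) - U i) * a i := by positivity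
      linarith
    by_contra hcon
    push Not at hcon
    have := mul_pos h2 hcon
    linarith

theorem concave_step (α T a b : ℝ) (hα0 : 0 < α) (hα1 : α < 1) (ha : 0 ≤ a) (hab : a < b)
    (hbT : b ≤ T) :
    ∫ s in a..b, α * (s ^ (α - 1) * (T - s) ^ (-α)) ≤
      ((b ^ α - a ^ α) / (b - a)) * ∫ s in a..b, (T - s) ^ (-α) := by
  obtain ⟨ξ, hξ, hslope⟩ := exists_hasDerivAt_eq_slope (fun s : ℝ => s ^ α)
    (fun s => α * s ^ (α - 1)) hab
    (fun s _ => (Real.continuousAt_rpow_const s α (Or.inr hα0.le)).continuousWithinAt)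
    (fun s hs => Real.hasDerivAt_rpow_const (Or.inl (by linarith [hs.1])))
  rw [← hslope]
  set c := α * ξ ^ (α - 1) with hc
  have hξ0 : 0 < ξ := by linarith [hξ.1]
  have hI1 : IntervalIntegrable (fun s => s ^ (α - 1) * (T - s) ^ (-α)) volume a b := by
    have h := rbeta_integrable α (1 - α) T hα0 (by linarith) (by linarith)
    rw [show 1 - α - 1 = -α by ring] at h
    apply h.mono_set
    rw [Set.uIcc_of_le hab.le, Set.uIcc_of_le (by linarith)]
    exact Set.Icc_subset_Icc ha hbT
  have hI2 : IntervalIntegrable (fun s : ℝ => s ^ (α - 1)) volume a b :=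
    intervalIntegral.intervalIntegrable_rpow' (by linarith)
  have hI3 := ker_integrable α T a b hα1
  have hzero : ∫ s in a..b, α * s ^ (α - 1) = c * (b - a) := by
    rw [intervalIntegral.integral_const_mul, integral_rpow (Or.inl (by linarith)),
      sub_add_cancel, hslope]
    have : b - a ≠ 0 := by linarith
    field_simp
  have hmono : ∫ s in a..b, (α * (s ^ (α - 1) * (T - s) ^ (-α)) - c * (T - s) ^ (-α)) ≤
      ∫ s in a..b, (T - ξ) ^ (-α) * (α * s ^ (α - 1) - c) := by
    apply intervalIntegral.integral_mono_on_of_le_Ioo hab.le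
    · exact (hI1.const_mul α).sub (hI3.const_mul c)
    · exact ((hI2.const_mul α).sub (by simp)).const_mul _
    · intro s hs
      have hs0 : 0 < s := by linarith [hs.1]
      have hgoal : (α * s ^ (α - 1) - c) * ((T - s) ^ (-α) - (T - ξ) ^ (-α)) ≤ 0 := by
        rcases le_total s ξ with h | h
        · apply mul_nonpos_of_nonneg_of_nonpos
          · have := Real.rpow_le_rpow_of_nonpos hs0 h (show α - 1 ≤ 0 by linarith)
            rw [hc]
            nlinarith
          · have := Real.rpow_le_rpow_of_nonpos (show 0 < T - ξ by linarith [hξ.2])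
              (show T - ξ ≤ T - s by linarith) (show -α ≤ 0 by linarith)
            linarith
        · apply mul_nonpos_of_nonpos_of_nonneg
          · have := Real.rpow_le_rpow_of_nonpos hξ0 h (show α - 1 ≤ 0 by linarith)
            rw [hc]
            nlinarith
          · have := Real.rpow_le_rpow_of_nonpos (show 0 < T - s by linarith [hs.2])
              (show T - s ≤ T - ξ by linarith) (show -α ≤ 0 by linarith)
            linarith
      nlinarith
  rw [intervalIntegral.integral_sub (hI1.const_mul α) (hI3.const_mul c),
    intervalIntegral.integral_const_mul, intervalIntegral.integral_const_mul,
    intervalIntegral.integral_const_mul,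
    intervalIntegral.integral_sub (hI2.const_mul α) (by simp), hzero] at hmono
  rw [intervalIntegral.integral_const_mul]
  simp only [intervalIntegral.integral_const, smul_eq_mul] at hmono
  have : (T - ξ) ^ (-α) * (c * (b - a) - (b - a) * c) = 0 := by ring
  linarith

theorem convex_integrable (α T a b c p : ℝ) (hα1 : α < 1) (hp : 1 ≤ p) :
    IntervalIntegrable (fun s => p * (max (s - c) 0 ^ (p - 1) * (T - s) ^ (-α))) volume a b := by
  apply IntervalIntegrable.const_mul
  apply (ker_integrable α T a b hα1).continuousOn_mul
  apply Continuous.continuousOn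
  apply Continuous.rpow_const
  · fun_prop
  · intro s; right; linarith

theorem convex_step (α T a b c p : ℝ) (hα0 : 0 < α) (hα1 : α < 1) (ha : 0 ≤ a) (hab : a < b)
    (hbT : b ≤ T) (hc : b - a ≤ c) (hp : 1 ≤ p) :
    ∫ s in a..b, p * (max (s - c) 0 ^ (p - 1) * (T - s) ^ (-α)) ≤
      ((b ^ p - a ^ p) / (b - a)) * ∫ s in a..b, (T - s) ^ (-α) := by
  obtain ⟨ξ, hξ, hslope⟩ := exists_hasDerivAt_eq_slope (fun s : ℝ => s ^ p)
    (fun s => p * s ^ (p - 1)) hab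
    (fun s _ => (Real.continuousAt_rpow_const s p (Or.inr (by linarith))).continuousWithinAt)
    (fun s hs => Real.hasDerivAt_rpow_const (Or.inr hp))
  rw [← hslope, ← intervalIntegral.integral_const_mul]
  apply intervalIntegral.integral_mono_on_of_le_Ioo hab.le
  · exact convex_integrable α T a b c p hα1 hp
  · exact (ker_integrable α T a b hα1).const_mul _
  · intro s hs
    have h1 : max (s - c) 0 ^ (p - 1) ≤ ξ ^ (p - 1) := by
      apply Real.rpow_le_rpow (le_max_right _ _) _ (by linarith)
      apply max_le <;> linarith [hs.2, hξ.1]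
    have h2 : 0 ≤ (T - s) ^ (-α) := Real.rpow_nonneg (by linarith [hs.2]) _
    rw [← mul_assoc]
    apply mul_le_mul_of_nonneg_right _ h2
    apply mul_le_mul_of_nonneg_left h1 (by linarith)

/-- The L1 operator applied to the building blocks. -/
theorem delta_block (α c : ℝ) (hα0 : 0 < α) (hα1 : α < 1) (hc : 0 < c) (M : ℕ) (t : ℕ → ℝ)
    (h0 : t 0 = 0) (ht : ∀ j, j < M → t j < t (j + 1)) (n : ℕ) (hn1 : 1 ≤ n) (hn : n ≤ M)
    (hstep : ∀ j, j < n → t (j + 1) - t j ≤ c) (k : ℕ) :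
    max (t n - c) 0 ^ k / (k.factorial : ℝ) ≤
      deltaL1 α t (fun j => t j ^ ((k : ℝ) + α) / Real.Gamma (k + α + 1)) n := by
  have hG := Real.Gamma_pos_of_pos (show 0 < 1 - α by linarith)
  have hT : 0 < t n := by
    have h1 := ht 0 (by omega)
    have h2 := mesh_le M t ht 1 n hn1 hn
    simp only [zero_add] at h1
    linarith
  have hnn : ∀ j, j ≤ M → 0 ≤ t j := fun j hj => by
    rw [← h0]; exact mesh_le M t ht 0 j (by omega) hj
  set p : ℝ := (k : ℝ) + α with hp
  have hp0 : 0 < p := by positivity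
  have hGp : Real.Gamma (p + 1) = p * Real.Gamma p := Real.Gamma_add_one hp0.ne'
  have hGp0 := Real.Gamma_pos_of_pos hp0
  have hform : deltaL1 α t (fun j => t j ^ p / Real.Gamma (p + 1)) n
      = (1 / Real.Gamma (1 - α)) * ((1 / (p * Real.Gamma p)) * ∑ i ∈ Finset.range n,
        ((t (i + 1) ^ p - t i ^ p) / (t (i + 1) - t i)) *
        ∫ s in (t i)..(t (i + 1)), (t n - s) ^ (-α)) := by
    rw [deltaL1_range, hGp, Finset.mul_sum (a := 1 / (p * Real.Gamma p))]
    congr 1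
    apply Finset.sum_congr rfl
    intro i _
    ring
  rw [hform]
  rcases Nat.eq_zero_or_pos k with hk | hk
  · have hpα : p = α := by rw [hp, hk]; simp
    rw [hk, hpα]
    simp only [pow_zero, Nat.factorial_zero, Nat.cast_one, div_one]
    have hI := rbeta_integrable α (1 - α) (t n) hα0 (by linarith) hT
    have hval := rbeta_integral α (1 - α) (t n) hα0 (by linarith) hT
    rw [show 1 - α - 1 = -α by ring] at hI hval
    have hadj := intervalIntegral.sum_integral_adjacent_intervals (μ := volume)
      (f := fun s => α * (s ^ (α - 1) * (t n - s) ^ (-α))) (a := t) (n := n) (by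
        intro i hi
        apply IntervalIntegrable.const_mul
        apply hI.mono_set
        rw [Set.uIcc_of_le (ht i (by omega)).le, Set.uIcc_of_le hT.le]
        exact Set.Icc_subset_Icc (hnn i (by omega)) (mesh_le M t ht _ _ (by omega) hn))
    have hle := Finset.sum_le_sum (s := Finset.range n) (fun i hi =>
      have hi' := Finset.mem_range.mp hi
      concave_step α (t n) (t i) (t (i + 1)) hα0 hα1 (hnn i (by omega)) (ht i (by omega))
        (mesh_le M t ht _ _ (by omega) hn))
    rw [hadj, h0, intervalIntegral.integral_const_mul, hval] at hle
    rw [show α + (1 - α) = 1 by ring] at hle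
    simp only [sub_self, Real.rpow_zero, Real.Gamma_one, div_one, one_mul] at hle
    rw [hpα] at hGp0
    calc (1:ℝ) = (1 / Real.Gamma (1 - α)) * ((1 / (α * Real.Gamma α)) *
          (α * (Real.Gamma α * Real.Gamma (1 - α)))) := by field_simp
      _ ≤ _ := by gcongr
  · have hp1 : 1 ≤ p := by
      have : (1:ℝ) ≤ k := by exact_mod_cast hk
      linarith
    have hadj := intervalIntegral.sum_integral_adjacent_intervals (μ := volume)
      (f := fun s => p * (max (s - c) 0 ^ (p - 1) * (t n - s) ^ (-α))) (a := t) (n := n)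
      (fun i _ => convex_integrable α (t n) _ _ c p hα1 hp1)
    have hle := Finset.sum_le_sum (s := Finset.range n) (fun i hi =>
      have hi' := Finset.mem_range.mp hi
      convex_step α (t n) (t i) (t (i + 1)) c p hα0 hα1 (hnn i (by omega)) (ht i (by omega))
        (mesh_le M t ht _ _ (by omega) hn) (hstep i hi') hp1)
    rw [hadj, h0] at hle
    have hposint : ∀ a b : ℝ, a ≤ b → b ≤ t n →
        0 ≤ ∫ s in a..b, p * (max (s - c) 0 ^ (p - 1) * (t n - s) ^ (-α)) := by
      intro a b hab hb
      apply intervalIntegral.integral_nonneg hab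
      intro s hs
      have h1 : 0 ≤ (t n - s) ^ (-α) := Real.rpow_nonneg (by linarith [hs.2]) _
      have h2 : 0 ≤ max (s - c) 0 ^ (p - 1) := Real.rpow_nonneg (le_max_right _ _) _
      positivity
    rcases le_or_gt (t n) c with hTc | hTc
    · rw [max_eq_right (by linarith), zero_pow (by omega), zero_div]
      have := (hposint 0 (t n) hT.le le_rfl).trans hle
      positivity
    · rw [max_eq_left (by linarith)]
      have hsplit := intervalIntegral.integral_add_adjacent_intervals
        (convex_integrable α (t n) 0 c c p hα1 hp1) (convex_integrable α (t n) c (t n) c p hα1 hp1)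
      have hsh : ∫ s in c..(t n), p * (max (s - c) 0 ^ (p - 1) * (t n - s) ^ (-α))
          = p * ((t n - c) ^ k * (Real.Gamma p * Real.Gamma (1 - α) / (k.factorial : ℝ))) := by
        have h1 := intervalIntegral.integral_comp_sub_right (a := c) (b := t n)
          (fun u => p * (max u 0 ^ (p - 1) * (t n - c - u) ^ (-α))) c
        simp only [sub_sub_sub_cancel_right, sub_self] at h1
        have h2 : ∀ s : ℝ, t n - c - (s - c) = t n - s := fun s => by ring
        rw [h1, intervalIntegral.integral_const_mul]
        have h3 := rbeta_integral p (1 - α) (t n - c) hp0 (by linarith) (by linarith)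
        rw [show 1 - α - 1 = -α by ring, show p + (1 - α) - 1 = k by rw [hp]; ring,
          show p + (1 - α) = k + 1 by rw [hp]; ring, Real.rpow_natCast,
          Real.Gamma_nat_eq_factorial] at h3
        rw [← h3]
        congr 1
        apply intervalIntegral.integral_congr
        intro s hs
        rw [Set.uIcc_of_le (by linarith)] at hs
        simp only
        rw [max_eq_left hs.1]
      have h5 := hposint 0 c hc.le hTc.le
      rw [← hsplit, hsh] at hle
      have hle' := (le_add_of_nonneg_left h5).trans hle
      calc (t n - c) ^ k / (k.factorial : ℝ) = (1 / Real.Gamma (1 - α)) * ((1 / (p * Real.Gamma p)) *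
          (p * ((t n - c) ^ k * (Real.Gamma p * Real.Gamma (1 - α) / (k.factorial : ℝ))))) := by
            field_simp
        _ ≤ _ := by gcongr

theorem delta_linear (α : ℝ) (t V W : ℕ → ℝ) (a b : ℝ) (n : ℕ) :
    deltaL1 α t (fun j => a * V j + b * W j) n = a * deltaL1 α t V n + b * deltaL1 α t W n := by
  simp only [deltaL1_range, Finset.mul_sum, ← Finset.sum_add_distrib]
  apply Finset.sum_congr rfl
  intro i _
  ring

theorem block_hasSum (α β x : ℝ) (hα0 : 0 < α) (hβ : 0 < β) (hx : 0 ≤ x) :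
    Summable (fun k : ℕ => β ^ k * (x ^ ((k : ℝ) + α) / Real.Gamma (k + α + 1))) ∧
    ∑' k : ℕ, β ^ k * (x ^ ((k : ℝ) + α) / Real.Gamma (k + α + 1)) ≤
      β ^ (-α) * Real.exp (β * x) := by
  have hnn : ∀ k : ℕ, 0 ≤ β ^ k * (x ^ ((k : ℝ) + α) / Real.Gamma (k + α + 1)) := by
    intro k
    have := Real.Gamma_pos_of_pos (show 0 < (k : ℝ) + α + 1 by positivity)
    positivity
  have hb : ∀ N : ℕ, ∑ k ∈ Finset.range N, β ^ k * (x ^ ((k : ℝ) + α) / Real.Gamma (k + α + 1)) ≤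
      β ^ (-α) * Real.exp (β * x) := by
    intro N
    have h := partial_le_exp α (β * x) hα0 (by positivity) N
    calc _ = β ^ (-α) * ∑ k ∈ Finset.range N, (β * x) ^ ((k : ℝ) + α) / Real.Gamma (k + α + 1) := by
          rw [Finset.mul_sum]
          apply Finset.sum_congr rfl
          intro k _
          rw [Real.mul_rpow hβ.le hx, Real.rpow_add hβ, Real.rpow_natCast, Real.rpow_neg hβ.le]
          have : β ^ α ≠ 0 := by positivity
          field_simp
      _ ≤ _ := by gcongr
  exact ⟨summable_of_sum_range_le hnn hb, Real.tsum_le_of_sum_range_le hnn hb⟩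

theorem delta_W (α β c : ℝ) (hα0 : 0 < α) (hα1 : α < 1) (hβ : 0 < β) (hc : 0 < c) (M : ℕ)
    (t : ℕ → ℝ)
    (h0 : t 0 = 0) (ht : ∀ j, j < M → t j < t (j + 1)) (n : ℕ) (hn1 : 1 ≤ n) (hn : n ≤ M)
    (hstep : ∀ j, j < n → t (j + 1) - t j ≤ c) :
    Real.exp (-(β * c)) * Real.exp (β * t n) ≤
      deltaL1 α t (fun j => ∑' k : ℕ, β ^ k * (t j ^ ((k : ℝ) + α) / Real.Gamma (k + α + 1))) n := by
  have hnn : ∀ j, j ≤ M → 0 ≤ t j := fun j hj => by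
    rw [← h0]; exact mesh_le M t ht 0 j (by omega) hj
  have hs : HasSum (fun k : ℕ => β ^ k *
      deltaL1 α t (fun j => t j ^ ((k : ℝ) + α) / Real.Gamma (k + α + 1)) n)
      (deltaL1 α t (fun j => ∑' k : ℕ, β ^ k *
        (t j ^ ((k : ℝ) + α) / Real.Gamma (k + α + 1))) n) := by
    have h1 : HasSum (fun k : ℕ => (1 / Real.Gamma (1 - α)) *
      ∑ i ∈ Finset.range n, ((β ^ k * (t (i + 1) ^ ((k : ℝ) + α) / Real.Gamma (k + α + 1))
        - β ^ k * (t i ^ ((k : ℝ) + α) / Real.Gamma (k + α + 1))) / (t (i + 1) - t i)) *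
        ∫ s in (t i)..(t (i + 1)), (t n - s) ^ (-α))
        (deltaL1 α t (fun j => ∑' k : ℕ, β ^ k *
        (t j ^ ((k : ℝ) + α) / Real.Gamma (k + α + 1))) n) := by
      rw [deltaL1_range]
      apply HasSum.mul_left
      apply hasSum_sum
      intro i hi
      have hi' := Finset.mem_range.mp hi
      apply HasSum.mul_right
      apply HasSum.div_const
      apply HasSum.sub
      · exact (block_hasSum α β _ hα0 hβ (hnn _ (by omega))).1.hasSum
      · exact (block_hasSum α β _ hα0 hβ (hnn _ (by omega))).1.hasSum
    convert h1 using 2 with k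
    rw [deltaL1_range, Finset.mul_sum, Finset.mul_sum, Finset.mul_sum]
    apply Finset.sum_congr rfl
    intro i _
    ring
  have he : HasSum (fun k : ℕ => (β * max (t n - c) 0) ^ k / (k.factorial : ℝ))
      (Real.exp (β * max (t n - c) 0)) := by
    rw [Real.exp_eq_exp_ℝ]
    exact NormedSpace.expSeries_div_hasSum_exp _
  have hle := hasSum_le (fun k => ?_) he hs
  · refine le_trans ?_ hle
    rw [← Real.exp_add]
    apply Real.exp_le_exp.mpr
    have := le_max_left (t n - c) 0
    nlinarith
  · rw [mul_pow, mul_div_assoc]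
    have := delta_block α c hα0 hα1 hc M t h0 ht n hn1 hn hstep k
    gcongr

theorem delta_ind (α : ℝ) (hα0 : 0 < α) (hα1 : α < 1) (M : ℕ) (t : ℕ → ℝ)
    (h0 : t 0 = 0) (ht : ∀ j, j < M → t j < t (j + 1)) (n : ℕ) (hn1 : 1 ≤ n) (hn : n ≤ M) :
    (t 1 / t n) ^ α ≤
      deltaL1 α t (fun j => if j = 0 then 0 else Real.Gamma (1 - α) * t 1 ^ α) n := by
  have hG := Real.Gamma_pos_of_pos (show 0 < 1 - α by linarith)
  have h1 := ht 0 (by omega)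
  simp only [zero_add, h0] at h1
  have h2 := mesh_le M t ht 1 n hn1 hn
  rw [deltaL1_range, Finset.sum_eq_single_of_mem 0 (Finset.mem_range.mpr (by omega))]
  · have h3 := ker_lower α (t n) 0 (t 1) hα0 hα1 h1 h2
    simp only [sub_zero] at h3
    simp only [zero_add, h0, sub_zero, if_true, one_ne_zero, if_false]
    have h4 : 0 < t n := by linarith
    calc (t 1 / t n) ^ α = 1 / Real.Gamma (1 - α) * (Real.Gamma (1 - α) * t 1 ^ α / t 1 *
          (t 1 * t n ^ (-α))) := by
          rw [Real.div_rpow h1.le h4.le, Real.rpow_neg h4.le]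
          field_simp
      _ ≤ _ := by gcongr
  · intro i _ hi
    simp [hi]

theorem one_sided (α lam β c : ℝ) (hα0 : 0 < α) (hα1 : α < 1) (hlam : 0 < lam) (hβ : 0 < β)
    (hc : 0 < c) (M : ℕ) (t : ℕ → ℝ)
    (h0 : t 0 = 0) (ht : ∀ j, j < M → t j < t (j + 1)) (m : ℕ) (hm : m ≤ M)
    (hstep : ∀ j, j < m → t (j + 1) - t j ≤ c) (V : ℕ → ℝ) (hV0 : V 0 = 0) (S : ℝ) (hS : 0 ≤ S)
    (hVS : ∀ j, 1 ≤ j → j ≤ m → V j ≤ S * Real.exp (β * t j))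
    (hV : ∀ j, 1 ≤ j → j ≤ m → deltaL1 α t V j - lam * V j ≤ (t 1 / t j) ^ α) :
    ∀ j, 1 ≤ j → j ≤ m → V j ≤ Real.Gamma (1 - α) * t 1 ^ α +
      lam * S * Real.exp (β * c) * β ^ (-α) * Real.exp (β * t j) := by
  set W : ℕ → ℝ := fun j => ∑' k : ℕ, β ^ k * (t j ^ ((k : ℝ) + α) / Real.Gamma (k + α + 1)) with hW
  set B : ℕ → ℝ := fun j => if j = 0 then 0 else Real.Gamma (1 - α) * t 1 ^ α with hB
  have hnn : ∀ j, j ≤ M → 0 ≤ t j := fun j hj => by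
    rw [← h0]; exact mesh_le M t ht 0 j (by omega) hj
  set A : ℝ := lam * S * Real.exp (β * c) with hA
  have hA0 : 0 ≤ A := by positivity
  have key := discrete_max α hα0 hα1 M t ht m hm
    (fun j => 1 * V j + (-1) * (1 * B j + A * W j)) ?_ ?_
  · intro j hj1 hj
    have h1 := key j hj
    have h2 : B j = Real.Gamma (1 - α) * t 1 ^ α := by
      rw [hB]; simp only; rw [if_neg (by omega)]
    have h3 : W j ≤ β ^ (-α) * Real.exp (β * t j) :=
      (block_hasSum α β (t j) hα0 hβ (hnn j (by omega))).2
    have h4 := mul_le_mul_of_nonneg_left h3 hA0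
    rw [h2] at h1
    linarith
  · have hW0 : 0 ≤ W 0 := by
      apply tsum_nonneg
      intro k
      have := Real.Gamma_pos_of_pos (show 0 < (k : ℝ) + α + 1 by positivity)
      have := hnn 0 (by omega)
      positivity
    have hB0 : B 0 = 0 := by simp [hB]
    have := mul_nonneg hA0 hW0
    simp only [hV0, hB0]
    linarith
  · intro j hj1 hj
    rw [delta_linear, delta_linear α t B W 1 A]
    have h1 := delta_ind α hα0 hα1 M t h0 ht j hj1 (by omega)
    have h2 := delta_W α β c hα0 hα1 hβ hc M t h0 ht j hj1 (by omega)
      (fun i hi => hstep i (by omega))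
    have h3 := hV j hj1 hj
    have h4 := mul_le_mul_of_nonneg_left (hVS j hj1 hj) hlam.le
    have h5 := mul_le_mul_of_nonneg_left h2 hA0
    have h6 : A * (Real.exp (-(β * c)) * Real.exp (β * t j)) = lam * (S * Real.exp (β * t j)) := by
      rw [hA, Real.exp_neg]
      field_simp
    rw [h6] at h5
    linarith

theorem stmt8
    (α lam lam' : ℝ) (hα : α ∈ Set.Ioo (0 : ℝ) 1)
    (hlam : 0 < lam) (hlam' : lam < lam') :
    ∃ c₀ > (0 : ℝ), ∃ C > (0 : ℝ), ∀ (T : ℝ), 0 < T → ∀ (M : ℕ) (t : ℕ → ℝ),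
      1 ≤ M → t 0 = 0 → t M = T →
      (∀ j, j < M → t j < t (j + 1)) →
      ∀ m, 1 ≤ m → m ≤ M →
      (∀ j, 1 ≤ j → j ≤ m → t j - t (j - 1) ≤ c₀) →
      ∀ V : ℕ → ℝ, V 0 = 0 →
      (∀ j, 1 ≤ j → j ≤ m →
        |deltaL1 α t V j - lam * V j| ≤ (t 1 / t j) ^ α) →
      ∀ j, 1 ≤ j → j ≤ m →
        |V j| ≤ C * (t 1) ^ α * mittagLeffler α (lam' * (t j) ^ α) := by
  obtain ⟨hα0, hα1⟩ := hα
  have hl' : 0 < lam' := hlam.trans hlam'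
  have hpow : lam ^ (1 / α) < lam' ^ (1 / α) := Real.rpow_lt_rpow hlam.le hlam' (by positivity)
  obtain ⟨β, hβ1, hβ2⟩ := exists_between hpow
  have hβ : 0 < β := lt_trans (by positivity) hβ1
  have hβα : lam < β ^ α := by
    have h := Real.rpow_lt_rpow (by positivity) hβ1 hα0
    rwa [← Real.rpow_mul hlam.le, one_div_mul_cancel hα0.ne', Real.rpow_one] at h
  obtain ⟨r, hr1, hr2⟩ := exists_between ((one_lt_div hlam).mpr hβα)
  set c := Real.log r / β with hcdef
  have hc : 0 < c := div_pos (Real.log_pos hr1) hβ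
  have hec : Real.exp (β * c) = r := by
    rw [hcdef, mul_div_cancel₀ _ hβ.ne', Real.exp_log (by linarith)]
  set q := lam * r * β ^ (-α) with hq
  have hq1 : q < 1 := by
    rw [hq, Real.rpow_neg hβ.le, ← div_eq_mul_inv, div_lt_one (by positivity)]
    rw [lt_div_iff₀ hlam] at hr2
    linarith
  have hG := Real.Gamma_pos_of_pos (show 0 < 1 - α by linarith)
  have hq1' : 0 < 1 - q := by linarith
  have hD : 0 < 1 - β / lam' ^ (1 / α) := by
    have : β / lam' ^ (1 / α) < 1 := by rw [div_lt_one (by positivity)]; exact hβ2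
    linarith
  refine ⟨c, hc, Real.Gamma (1 - α) / (1 - q) * (Real.exp 1 / (1 - β / lam' ^ (1 / α))),
    by positivity, ?_⟩
  intro T hT M t hM h0 hTM ht m hm1 hm hstep V hV0 hV
  have hstep' : ∀ j, j < m → t (j + 1) - t j ≤ c := fun j hj => by
    simpa using hstep (j + 1) (by omega) (by omega)
  have hnn : ∀ j, j ≤ M → 0 ≤ t j := fun j hj => by
    rw [← h0]; exact mesh_le M t ht 0 j (by omega) hj
  obtain ⟨j₀, hj₀, hmax⟩ := Finset.exists_max_image (Finset.Icc 1 m)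
    (fun j => |V j| * Real.exp (-(β * t j))) ⟨1, Finset.mem_Icc.mpr ⟨le_rfl, hm1⟩⟩
  rw [Finset.mem_Icc] at hj₀
  set S := |V j₀| * Real.exp (-(β * t j₀)) with hS
  have hS0 : 0 ≤ S := by positivity
  have hVS : ∀ j, 1 ≤ j → j ≤ m → |V j| ≤ S * Real.exp (β * t j) := by
    intro j hj1 hj
    have h := hmax j (Finset.mem_Icc.mpr ⟨hj1, hj⟩)
    have h2 := mul_le_mul_of_nonneg_right h (Real.exp_pos (β * t j)).le
    rwa [mul_assoc, ← Real.exp_add, neg_add_cancel, Real.exp_zero, mul_one] at h2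
  have hup := one_sided α lam β c hα0 hα1 hlam hβ hc M t h0 ht m hm hstep' V hV0 S hS0
    (fun j h1 h2 => (le_abs_self _).trans (hVS j h1 h2))
    (fun j h1 h2 => (le_abs_self _).trans (hV j h1 h2))
  have hneg : ∀ j, deltaL1 α t (fun j => -V j) j = - deltaL1 α t V j := by
    intro j
    have := delta_linear α t V V (-1) 0 j
    simpa using this
  have hdn := one_sided α lam β c hα0 hα1 hlam hβ hc M t h0 ht m hm hstep' (fun j => -V j)
    (by simp [hV0]) S hS0
    (fun j h1 h2 => (neg_le_abs _).trans (hVS j h1 h2))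
    (fun j h1 h2 => by
      rw [hneg]
      have := (neg_le_abs _).trans (hV j h1 h2)
      linarith)
  have hb : ∀ j, 1 ≤ j → j ≤ m → |V j| ≤ Real.Gamma (1 - α) * t 1 ^ α +
      q * S * Real.exp (β * t j) := by
    intro j h1 h2
    have h3 := hup j h1 h2
    have h4 := hdn j h1 h2
    rw [hec] at h3 h4
    have h5 : lam * S * r * β ^ (-α) = q * S := by rw [hq]; ring
    rw [h5] at h3 h4
    exact abs_le.mpr ⟨by linarith, h3⟩
  have ht1 : 0 ≤ t 1 := hnn 1 hM
  have hSb : S ≤ Real.Gamma (1 - α) / (1 - q) * t 1 ^ α := by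
    have h1 := mul_le_mul_of_nonneg_right (hb j₀ hj₀.1 hj₀.2) (Real.exp_pos (-(β * t j₀))).le
    rw [← hS, add_mul, mul_assoc (q * S), ← Real.exp_add, add_neg_cancel, Real.exp_zero,
      mul_one] at h1
    have h2 : Real.exp (-(β * t j₀)) ≤ 1 := by
      apply Real.exp_le_one_iff.mpr
      have := hnn j₀ (by omega)
      have := mul_nonneg hβ.le this
      linarith
    have h3 : 0 ≤ Real.Gamma (1 - α) * t 1 ^ α := by positivity
    have h4 := mul_le_mul_of_nonneg_left h2 h3
    rw [div_mul_eq_mul_div, le_div_iff₀ hq1']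
    linarith
  intro j hj1 hj
  have hml := exp_le_ml α lam' β (t j) hα0 hα1 hl' hβ hβ2 (hnn j (by omega))
  calc |V j| ≤ S * Real.exp (β * t j) := hVS j hj1 hj
    _ ≤ (Real.Gamma (1 - α) / (1 - q) * t 1 ^ α) * Real.exp (β * t j) := by gcongr
    _ ≤ (Real.Gamma (1 - α) / (1 - q) * t 1 ^ α) *
      ((Real.exp 1 / (1 - β / lam' ^ (1 / α))) * mittagLeffler α (lam' * t j ^ α)) := by gcongr
    _ = _ := by ring
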